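/- arXiv:2207.04338 — 4 statements merged into one kernel-verified Lean document; each statement's English description precedes it below -/
import Mathlib

section
/- Let γ, μ, p, A, B, C, Ã, B̃, C̃, W be real numbers with γ > 0, μ > 0, γμ ≤ 1, 0 < p ≤ 1, A, B, C, Ã, B̃, C̃ ≥ 0, B̃ < 1, W > B/(1−B̃) if B > 0 (and W = 0 if B = 0), and γ ≤ 1/(A + W·Ã). Set β := (B + W·B̃)/W when W > 0 and β := B̃ when W = 0. Suppose nonnegative real numbers r, D, σ, H, V, σ' satisfy the two inequalities V ≤ (1−γμ)·r − 2γ(1−γA)·D + γ²·B·σ + γ²·C + (1−p²)·H and σ' ≤ 2Ã·D + B̃·σ + C̃. Then V + γ²·W·σ' ≤ max{1−γμ, β, 1−p²}·(r + H + γ²·W·σ) + γ²·(C + W·C̃). -/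
/-- One-step combination at the heart of the main convergence theorem for ProxSkip-VR. -/
theorem proxskip_vr_one_step
    (γ μ p A B C At Bt Ct W β r D σ H V σ' : ℝ)
    (hγ : 0 < γ) (hμ : 0 < μ) (hγμ : γ * μ ≤ 1)
    (hp0 : 0 < p) (hp1 : p ≤ 1)
    (hA : 0 ≤ A) (hB : 0 ≤ B) (hC : 0 ≤ C)
    (hAt : 0 ≤ At) (hBt : 0 ≤ Bt) (hCt : 0 ≤ Ct) (hBt1 : Bt < 1)
    (hWpos : 0 < B → B / (1 - Bt) < W)
    (hW0 : B = 0 → W = 0)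
    (hβpos : 0 < W → β = (B + W * Bt) / W)
    (hβ0 : W = 0 → β = Bt)
    (hstep : γ ≤ 1 / (A + W * At))
    (hr : 0 ≤ r) (hD : 0 ≤ D) (hσ : 0 ≤ σ) (hH : 0 ≤ H) (hV : 0 ≤ V) (hσ' : 0 ≤ σ')
    (h1 : V ≤ (1 - γ * μ) * r - 2 * γ * (1 - γ * A) * D
            + γ ^ 2 * B * σ + γ ^ 2 * C + (1 - p ^ 2) * H)
    (h2 : σ' ≤ 2 * At * D + Bt * σ + Ct) :
    V + γ ^ 2 * W * σ' ≤
      max (max (1 - γ * μ) β) (1 - p ^ 2) * (r + H + γ ^ 2 * W * σ)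
        + γ ^ 2 * (C + W * Ct) := by
  have hW : 0 ≤ W := by
    rcases hB.eq_or_lt with h | h
    · exact (hW0 h.symm).ge
    · exact (div_nonneg hB (sub_pos.2 hBt1).le).trans (hWpos h).le
  have hβW : W * β = B + W * Bt := by
    rcases hW.eq_or_lt with h | h
    · have hB0 : B = 0 := by
        by_contra hne
        have hlt := hWpos (hB.lt_of_ne' hne)
        have := div_nonneg hB (sub_pos.2 hBt1).le
        linarith
      rw [← h, hB0]
      ring
    · rw [hβpos h, mul_div_cancel₀ _ h.ne']
  have hγA : γ * (A + W * At) ≤ 1 := by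
    rcases (add_nonneg hA (mul_nonneg hW hAt)).eq_or_lt with h | h
    · rw [← h]
      norm_num
    · exact (le_div_iff₀ h).1 hstep
  set M := max (max (1 - γ * μ) β) (1 - p ^ 2)
  have hMr : (1 - γ * μ) * r ≤ M * r :=
    mul_le_mul_of_nonneg_right ((le_max_left _ _).trans (le_max_left _ _)) hr
  have hMσ : β * (γ ^ 2 * W * σ) ≤ M * (γ ^ 2 * W * σ) :=
    mul_le_mul_of_nonneg_right ((le_max_right _ _).trans (le_max_left _ _)) (by positivity)
  have hMH : (1 - p ^ 2) * H ≤ M * H :=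
    mul_le_mul_of_nonneg_right (le_max_right _ _) hH
  have hσW : γ ^ 2 * W * σ' ≤ γ ^ 2 * W * (2 * At * D + Bt * σ + Ct) :=
    mul_le_mul_of_nonneg_left h2 (by positivity)
  have hDγ : 0 ≤ 2 * γ * D * (1 - γ * (A + W * At)) :=
    mul_nonneg (by positivity) (sub_nonneg.2 hγA)
  have hσβ : β * (γ ^ 2 * W * σ) = γ ^ 2 * (B + W * Bt) * σ := by
    rw [← hβW]
    ring
  linarith
end

section
/- Let E be a real Hilbert space, ψ : E → ℝ a convex function, γ > 0 and 0 < p ≤ 1. Let ŵ, w_⋆, h, h_⋆ ∈ E and set x̂ := ŵ + γ·h and suppose w_⋆ = x_⋆ − γ·h_⋆ for some x_⋆ ∈ E. Assume that u ∈ E minimizes the function z ↦ ψ(z) + (p/(2γ))·‖z − (x̂ − (γ/p)·h)‖² over E, and that x_⋆ minimizes the function z ↦ ψ(z) + (p/(2γ))·‖z − (x_⋆ − (γ/p)·h_⋆)‖² over E. Then p·(‖u − x_⋆‖² + (γ²/p²)·‖h + (p/γ)(u − x̂) − h_⋆‖²) + (1−p)·(‖x̂ − x_⋆‖² + (γ²/p²)·‖h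 − h_⋆‖²) ≤ ‖ŵ − w_⋆‖² + (1−p²)·(γ²/p²)·‖h − h_⋆‖². -/
open RealInnerProductSpace

/-- Three-point inequality: a minimizer `u` of `ψ + c‖· - a‖²` with `ψ` convex satisfies a
quadratic growth bound. -/
theorem ConvexOn.add_mul_sq_norm_le_of_isMinOn
    {E : Type*} [NormedAddCommGroup E] [InnerProductSpace ℝ E]
    {ψ : E → ℝ} (hψ : ConvexOn ℝ Set.univ ψ) {c : ℝ} {a u : E}
    (hu : IsMinOn (fun z => ψ z + c * ‖z - a‖ ^ 2) Set.univ u) (z : E) :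
    ψ u + c * ‖u - a‖ ^ 2 + c * ‖z - u‖ ^ 2 ≤ ψ z + c * ‖z - a‖ ^ 2 := by
  have segment_bound : ∀ t : ℝ, 0 < t → t < 1 →
      ψ u + c * ‖u - a‖ ^ 2 + c * (1 - t) * ‖z - u‖ ^ 2 ≤ ψ z + c * ‖z - a‖ ^ 2 := by
    intro t ht0 ht1
    have hmin : ψ u + c * ‖u - a‖ ^ 2 ≤
        ψ ((1 - t) • u + t • z) + c * ‖(1 - t) • u + t • z - a‖ ^ 2 :=
      isMinOn_iff.1 hu _ (Set.mem_univ _)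
    have hconv := hψ.2 (Set.mem_univ u) (Set.mem_univ z)
      (by linarith : 0 ≤ 1 - t) ht0.le (by ring)
    have hnorm : ‖(1 - t) • u + t • z - a‖ ^ 2 =
        (1 - t) * ‖u - a‖ ^ 2 + t * ‖z - a‖ ^ 2 - t * (1 - t) * ‖z - u‖ ^ 2 := by
      have hpoint : (1 - t) • u + t • z - a = (u - a) + t • (z - u) := by module
      have hend : z - a = (u - a) + (z - u) := by module
      rw [hpoint, hend, norm_add_sq_real, norm_add_sq_real, real_inner_smul_right, norm_smul,
        mul_pow, Real.norm_eq_abs, sq_abs]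
      ring
    rw [hnorm] at hmin
    simp only [smul_eq_mul] at hconv
    refine le_of_mul_le_mul_left ?_ ht0
    linear_combination hmin + hconv
  have hlim : Filter.Tendsto
      (fun t : ℝ => ψ u + c * ‖u - a‖ ^ 2 + c * (1 - t) * ‖z - u‖ ^ 2)
      (nhdsWithin 0 (Set.Ioi 0)) (nhds (ψ u + c * ‖u - a‖ ^ 2 + c * ‖z - u‖ ^ 2)) := by
    have hcont : Continuous
        (fun t : ℝ => ψ u + c * ‖u - a‖ ^ 2 + c * (1 - t) * ‖z - u‖ ^ 2) := by fun_prop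
    simpa using (hcont.tendsto 0).mono_left nhdsWithin_le_nhds
  refine le_of_tendsto hlim ?_
  filter_upwards [Ioo_mem_nhdsGT (zero_lt_one' ℝ)] with t ht
  exact segment_bound t ht.1 ht.2

/-- Firm nonexpansiveness of the proximal map of a convex function. -/
theorem ConvexOn.sq_norm_sub_le_inner_of_isMinOn
    {E : Type*} [NormedAddCommGroup E] [InnerProductSpace ℝ E]
    {ψ : E → ℝ} (hψ : ConvexOn ℝ Set.univ ψ) {c : ℝ} (hc : 0 < c) {a b u v : E}
    (hu : IsMinOn (fun z => ψ z + c * ‖z - a‖ ^ 2) Set.univ u)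
    (hv : IsMinOn (fun z => ψ z + c * ‖z - b‖ ^ 2) Set.univ v) :
    ‖u - v‖ ^ 2 ≤ ⟪u - v, a - b⟫ := by
  have huv := hψ.add_mul_sq_norm_le_of_isMinOn hu v
  have hvu := hψ.add_mul_sq_norm_le_of_isMinOn hv u
  have hva : ‖v - a‖ ^ 2 = ‖u - a‖ ^ 2 - 2 * ⟪u - a, u - v⟫ + ‖u - v‖ ^ 2 := by
    rw [← norm_sub_sq_real]
    congr 2
    abel
  have hub : ‖u - b‖ ^ 2 = ‖v - b‖ ^ 2 + 2 * ⟪v - b, u - v⟫ + ‖u - v‖ ^ 2 := by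
    rw [← norm_add_sq_real]
    congr 2
    abel
  have hinner : ⟪u - a, u - v⟫ - ⟪v - b, u - v⟫ = ‖u - v‖ ^ 2 - ⟪u - v, a - b⟫ := by
    rw [← inner_sub_left, ← real_inner_self_eq_norm_sq, ← inner_sub_right, real_inner_comm]
    congr 1
    abel
  rw [hva, norm_sub_rev v u] at huv
  rw [hub] at hvu
  refine le_of_mul_le_mul_left ?_ hc
  linear_combination (huv + hvu) / 2 - c * hinner

/-- Main lemma of ProxSkip (Lemma A.1): the expected contraction of
`‖x_{t+1} − x_⋆‖² + (γ²/p²)‖h_{t+1} − h_⋆‖²` under the probabilistic prox step. -/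
theorem proxskip_main_lemma
    {E : Type*} [NormedAddCommGroup E] [InnerProductSpace ℝ E] [CompleteSpace E]
    (ψ : E → ℝ) (hψ : ConvexOn ℝ Set.univ ψ)
    (γ p : ℝ) (hγ : 0 < γ) (hp0 : 0 < p) (hp1 : p ≤ 1)
    (what wstar h hstar xstar xhat u : E)
    (hxhat : xhat = what + γ • h)
    (hwstar : wstar = xstar - γ • hstar)
    (hu : IsMinOn (fun z => ψ z + p / (2 * γ) * ‖z - (xhat - (γ / p) • h)‖ ^ 2)
        Set.univ u)
    (hxstar : IsMinOn (fun z => ψ z + p / (2 * γ) * ‖z - (xstar - (γ / p) • hstar)‖ ^ 2)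
        Set.univ xstar) :
    p * (‖u - xstar‖ ^ 2 + γ ^ 2 / p ^ 2 * ‖h + (p / γ) • (u - xhat) - hstar‖ ^ 2)
        + (1 - p) * (‖xhat - xstar‖ ^ 2 + γ ^ 2 / p ^ 2 * ‖h - hstar‖ ^ 2) ≤
      ‖what - wstar‖ ^ 2 + (1 - p ^ 2) * (γ ^ 2 / p ^ 2) * ‖h - hstar‖ ^ 2 := by
  have hfirm := hψ.sq_norm_sub_le_inner_of_isMinOn (by positivity) hu hxstar
  have hprox : xhat - (γ / p) • h - (xstar - (γ / p) • hstar) =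
      (xhat - xstar) - (γ / p) • (h - hstar) := by module
  have hdual : γ ^ 2 / p ^ 2 * ‖h + (p / γ) • (u - xhat) - hstar‖ ^ 2 =
      ‖(u - xstar) - ((xhat - xstar) - (γ / p) • (h - hstar))‖ ^ 2 := by
    have hscale : (u - xstar) - ((xhat - xstar) - (γ / p) • (h - hstar)) =
        (γ / p) • (h + (p / γ) • (u - xhat) - hstar) := by
      match_scalars <;> field_simp <;> ring
    rw [hscale, norm_smul, mul_pow, Real.norm_eq_abs, sq_abs, div_pow]
  have hforward : what - wstar = (xhat - xstar) - γ • (h - hstar) := by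
    rw [hxhat, hwstar]
    module
  have hexpand : ∀ s : ℝ, ‖(xhat - xstar) - s • (h - hstar)‖ ^ 2 =
      ‖xhat - xstar‖ ^ 2 - 2 * s * ⟪xhat - xstar, h - hstar⟫ + s ^ 2 * ‖h - hstar‖ ^ 2 := by
    intro s
    rw [norm_sub_sq_real, real_inner_smul_right, norm_smul, mul_pow, Real.norm_eq_abs, sq_abs]
    ring
  rw [hprox] at hfirm
  rw [mul_add p, hdual, norm_sub_sq_real (u - xstar), hforward, hexpand, hexpand]
  have hscaled := mul_le_mul_of_nonneg_left hfirm (by positivity : 0 ≤ 2 * p)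
  have hcross : p * (γ / p) = γ := by field_simp
  linear_combination hscaled +
    (‖h - hstar‖ ^ 2 * (p * (γ / p) + γ) - 2 * ⟪xhat - xstar, h - hstar⟫) * hcross
end

section
/- Let E be a real inner product space, n ≥ 2 and 1 ≤ τ ≤ n integers, and a_1, …, a_n ∈ E. Then (1/binom(n,τ))·Σ_{S ⊆ {1,…,n}, |S| = τ} ‖(1/τ)·Σ_{j∈S} a_j‖² = ((n−τ)/(τ(n−1)))·(1/n)·Σ_{j=1}^n ‖a_j‖² + (n(τ−1)/(τ(n−1)))·‖(1/n)·Σ_{j=1}^n a_j‖². -/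
/-- Double counting of the pairs `T ⊆ S` with `#T = m`, `#S = k` in a finite type. -/
lemma choose_card_mul_card_filter_powersetCard_subset {ι : Type*} [Fintype ι] [DecidableEq ι]
    (T : Finset ι) (k : ℕ) :
    (Fintype.card ι).choose T.card *
        ((Finset.powersetCard k (Finset.univ : Finset ι)).filter (T ⊆ ·)).card
      = (Fintype.card ι).choose k * k.choose T.card := by
  rcases le_or_gt T.card k with h | h
  · rw [Finset.card_filter_powersetCard_subset T _ k (Finset.subset_univ T) h, Finset.card_univ,
      Nat.choose_mul h]
  · rw [Nat.choose_eq_zero_of_lt h, Finset.filter_eq_empty_iff.mpr]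
    · simp
    · intro S hS hTS
      have := Finset.card_le_card hTS
      rw [Finset.mem_powersetCard_univ] at hS
      omega

/-- The sum over all `k`-subsets `S` of `‖∑ j ∈ S, a j‖ ^ 2`, with each inner product weighted by
the number of `k`-subsets containing both indices. -/
lemma sum_powersetCard_norm_sum_sq {ι E : Type*} [Fintype ι] [DecidableEq ι]
    [NormedAddCommGroup E] [InnerProductSpace ℝ E] (k : ℕ) (a : ι → E) :
    ∑ S ∈ Finset.powersetCard k (Finset.univ : Finset ι), ‖∑ j ∈ S, a j‖ ^ 2
      = ∑ i, ∑ j, (((Finset.powersetCard k (Finset.univ : Finset ι)).filter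
          (({i, j} : Finset ι) ⊆ ·)).card : ℝ) * inner ℝ (a i) (a j) := by
  have expand (S : Finset ι) : ‖∑ j ∈ S, a j‖ ^ 2
      = ∑ i, ∑ j, if ({i, j} : Finset ι) ⊆ S then inner ℝ (a i) (a j) else (0 : ℝ) := by
    simp only [← real_inner_self_eq_norm_sq, sum_inner, inner_sum, Finset.insert_subset_iff,
      Finset.singleton_subset_iff, ite_and]
    rw [← Finset.sum_subset (Finset.subset_univ S) (by simp +contextual)]
    refine Finset.sum_congr rfl fun i hi => ?_
    simpa [hi] using Finset.sum_congr rfl fun j _ => real_inner_comm (a i) (a j)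
  simp only [expand]
  rw [Finset.sum_comm]
  refine Finset.sum_congr rfl fun i _ => ?_
  rw [Finset.sum_comm]
  refine Finset.sum_congr rfl fun j _ => ?_
  rw [← Finset.sum_filter, Finset.sum_const, nsmul_eq_mul]


/-- Second-moment identity for τ-nice minibatch sampling (Lemma D.1):
the expected squared norm of the subsample mean decomposes exactly. -/
theorem minibatch_second_moment_identity
    {E : Type*} [NormedAddCommGroup E] [InnerProductSpace ℝ E]
    (n τ : ℕ) (hn : 2 ≤ n) (hτ1 : 1 ≤ τ) (hτn : τ ≤ n) (a : Fin n → E) :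
    ((n.choose τ : ℝ))⁻¹ *
        ∑ S ∈ Finset.powersetCard τ (Finset.univ : Finset (Fin n)),
          ‖((τ : ℝ))⁻¹ • ∑ j ∈ S, a j‖ ^ 2
      = ((n : ℝ) - τ) / (τ * ((n : ℝ) - 1)) * (((n : ℝ))⁻¹ * ∑ j, ‖a j‖ ^ 2)
        + (n : ℝ) * ((τ : ℝ) - 1) / (τ * ((n : ℝ) - 1)) * ‖((n : ℝ))⁻¹ • ∑ j, a j‖ ^ 2 := by
  have hn0 : (n : ℝ) ≠ 0 := by positivity
  have hτ0 : (τ : ℝ) ≠ 0 := by positivity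
  have hn1 : (n : ℝ) - 1 ≠ 0 := by
    have : (2 : ℝ) ≤ n := by exact_mod_cast hn
    linarith
  have hC : (n.choose τ : ℝ) ≠ 0 := by exact_mod_cast (Nat.choose_pos hτn).ne'
  have count (i j : Fin n) :
      (((Finset.powersetCard τ (Finset.univ : Finset (Fin n))).filter
          (({i, j} : Finset (Fin n)) ⊆ ·)).card : ℝ)
        = n.choose τ * (τ * (τ - 1) / (n * (n - 1))
          + if i = j then (τ : ℝ) * (n - τ) / (n * (n - 1)) else 0) := by
    have h := choose_card_mul_card_filter_powersetCard_subset ({i, j} : Finset (Fin n)) τ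
    rw [Fintype.card_fin] at h
    have h := congrArg (Nat.cast : ℕ → ℝ) h
    push_cast at h
    by_cases hij : i = j
    · subst hij
      simp only [Finset.pair_eq_singleton, Finset.card_singleton, Nat.choose_one_right] at h ⊢
      simp only [if_true]
      field_simp
      linear_combination (n - 1 : ℝ) * h
    · rw [Finset.card_pair hij, Nat.cast_choose_two, Nat.cast_choose_two] at h
      simp only [if_neg hij, add_zero]
      field_simp
      linear_combination 2 * h
  have hsum : ∑ S ∈ Finset.powersetCard τ (Finset.univ : Finset (Fin n)), ‖∑ j ∈ S, a j‖ ^ 2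
      = n.choose τ * (τ * (τ - 1) / (n * (n - 1)) * ‖∑ j, a j‖ ^ 2
          + τ * (n - τ) / (n * (n - 1)) * ∑ j, ‖a j‖ ^ 2) := by
    rw [sum_powersetCard_norm_sum_sq, ← real_inner_self_eq_norm_sq (∑ j, a j)]
    simp only [count, sum_inner, inner_sum, mul_assoc, add_mul, ite_mul, zero_mul,
      ← Finset.mul_sum, Finset.sum_add_distrib, Finset.sum_ite_eq, Finset.mem_univ, if_true,
      real_inner_self_eq_norm_sq]
    rw [Finset.sum_comm]
  simp only [norm_smul, mul_pow, norm_inv, Real.norm_natCast, ← Finset.mul_sum, hsum]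
  field_simp
  ring
end

section
/- Let E be a real inner product space, n ≥ 2 and 1 ≤ τ ≤ n integers. Let φ_1, …, φ_n : E → ℝ be convex and differentiable with each φ_j L_j-smooth (L_j > 0), and suppose f := (1/n)·Σ_{j=1}^n φ_j is convex and L-smooth with L > 0. Define L(τ) := ((n−τ)/(τ(n−1)))·max_j L_j + (n(τ−1)/(τ(n−1)))·L. Then for all x, y, z ∈ E: (1/binom(n,τ))·Σ_{S ⊆ {1,…,n}, |S| = τ} ‖(1/τ)·Σ_{j∈S}(∇φ_j(x) − ∇φ_j(y)) + ∇f(y) − ∇f(z)‖² ≤ 4·L(τ)·D_f(x, z) + 2·(1/binom(n,τ))·Σ_{S ⊆ {1,…,n}, |S| = τ} ‖(1/τ)·Σ_{j∈S}(∇φ_j(y) − ∇φ_j(z))‖². -/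
open RealInnerProductSpace

/-- First-order (tangent) characterisation of convexity. -/
theorem ConvexOn.add_inner_le_of_hasFDerivAt
    {E : Type*} [NormedAddCommGroup E] [InnerProductSpace ℝ E]
    {g : E → ℝ} {v y : E} (hg : ConvexOn ℝ Set.univ g)
    (hd : HasFDerivAt g (innerSL ℝ v) y) (x : E) :
    g y + ⟪v, x - y⟫ ≤ g x := by
  have hline : HasDerivAt (fun t : ℝ => g (AffineMap.lineMap y x t)) ⟪v, x - y⟫ 0 := by
    have hd' : HasFDerivAt g (innerSL ℝ v) (AffineMap.lineMap y x (0 : ℝ)) := by simpa using hd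
    have h := hd'.comp_hasDerivAt (0 : ℝ) AffineMap.hasDerivAt_lineMap
    rwa [innerSL_apply_apply] at h
  have hconv : ConvexOn ℝ Set.univ (fun t : ℝ => g (AffineMap.lineMap y x t)) :=
    hg.comp_affineMap (AffineMap.lineMap y x)
  have h := hconv.le_slope_of_hasDerivAt (Set.mem_univ _) (Set.mem_univ _) zero_lt_one hline
  simp [slope_def_field] at h
  linarith

/-- A function lying above its tangents and `M`-smooth satisfies the co-coercivity bound
`‖∇g(x) − ∇g(z)‖² ≤ 2M·D_g(x,z)`. -/
theorem norm_sub_sq_le_bregman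
    {E : Type*} [NormedAddCommGroup E] [InnerProductSpace ℝ E]
    {g : E → ℝ} {g' : E → E} {M : ℝ} (hM : 0 < M)
    (htangent : ∀ x y, g y + ⟪g' y, x - y⟫ ≤ g x)
    (hsmooth : ∀ x y, g x - g y - ⟪g' y, x - y⟫ ≤ M / 2 * ‖x - y‖ ^ 2) (x z : E) :
    ‖g' x - g' z‖ ^ 2 ≤ 2 * M * (g x - g z - ⟪g' z, x - z⟫) := by
  set w := g' x - g' z with hw
  have h1 := htangent (x - M⁻¹ • w) z
  have h2 := hsmooth (x - M⁻¹ • w) x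
  have e1 : x - M⁻¹ • w - z = (x - z) - M⁻¹ • w := by abel
  have e2 : x - M⁻¹ • w - x = -(M⁻¹ • w) := by abel
  rw [e1, inner_sub_right, inner_smul_right] at h1
  rw [e2, inner_neg_right, inner_smul_right, norm_neg, norm_smul, Real.norm_eq_abs, mul_pow,
    sq_abs] at h2
  have h3 : ⟪g' x, w⟫ - ⟪g' z, w⟫ = ‖w‖ ^ 2 := by
    rw [← inner_sub_left, ← hw, real_inner_self_eq_norm_sq]
  have h4 : M⁻¹ * ‖w‖ ^ 2 - M / 2 * (M⁻¹ ^ 2 * ‖w‖ ^ 2) ≤ g x - g z - ⟪g' z, x - z⟫ := by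
    rw [← h3] at h2 ⊢
    linarith
  have h5 : M⁻¹ * ‖w‖ ^ 2 - M / 2 * (M⁻¹ ^ 2 * ‖w‖ ^ 2) = ‖w‖ ^ 2 / (2 * M) := by
    field_simp; norm_num
  rw [h5, div_le_iff₀ (by positivity)] at h4
  linarith

/-- The number of `k`-subsets of a finite type that contain a given set `T`. -/
theorem Finset.choose_card_mul_card_filter_subset {ι : Type*} [Fintype ι] [DecidableEq ι]
    (k : ℕ) (T : Finset ι) :
    (Fintype.card ι).choose T.card *
        (((Finset.univ : Finset ι).powersetCard k).filter (fun S => T ⊆ S)).card =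
      (Fintype.card ι).choose k * k.choose T.card := by
  by_cases hk : T.card ≤ k
  · rw [Finset.card_filter_powersetCard_subset T Finset.univ k (Finset.subset_univ T) hk,
      Finset.card_univ, Nat.choose_mul hk]
  · have hempty : ((Finset.univ : Finset ι).powersetCard k).filter (fun S => T ⊆ S) = ∅ := by
      refine Finset.filter_eq_empty_iff.2 fun S hS hTS => hk ?_
      rw [← (Finset.mem_powersetCard.1 hS).2]
      exact Finset.card_le_card hTS
    rw [hempty, Nat.choose_eq_zero_of_lt (not_le.1 hk)]
    simp

/-- First moment of the sum over a uniformly random `k`-subset. -/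
theorem Finset.card_smul_sum_powersetCard_sum {ι E : Type*} [Fintype ι]
    [AddCommGroup E] [Module ℝ E] (k : ℕ) (b : ι → E) :
    (Fintype.card ι : ℝ) • ∑ S ∈ (Finset.univ : Finset ι).powersetCard k, ∑ j ∈ S, b j =
      ((Fintype.card ι).choose k * k : ℝ) • ∑ j, b j := by
  classical
  have hswap : ∑ S ∈ (Finset.univ : Finset ι).powersetCard k, ∑ j ∈ S, b j =
      ∑ j, ((((Finset.univ : Finset ι).powersetCard k).filter
        (fun S => {j} ⊆ S)).card : ℝ) • b j := by
    have hS (S : Finset ι) : ∑ j ∈ S, b j = ∑ j, if {j} ⊆ S then b j else 0 := by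
      simp
    simp_rw [hS]
    rw [Finset.sum_comm]
    refine Finset.sum_congr rfl fun j _ => ?_
    rw [← Finset.sum_filter, Finset.sum_const, Nat.cast_smul_eq_nsmul]
  rw [hswap, Finset.smul_sum, Finset.smul_sum]
  refine Finset.sum_congr rfl fun j _ => ?_
  have h := Finset.choose_card_mul_card_filter_subset k {j}
  rw [Finset.card_singleton, Nat.choose_one_right, Nat.choose_one_right] at h
  rw [smul_smul]
  exact_mod_cast congrArg (fun m : ℕ => (m : ℝ) • b j) h

/-- Second moment of the sum over a uniformly random `k`-subset. -/
theorem Finset.card_mul_sum_powersetCard_norm_sum_sq {ι E : Type*} [Fintype ι]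
    [NormedAddCommGroup E] [InnerProductSpace ℝ E] (k : ℕ) (a : ι → E) :
    (Fintype.card ι : ℝ) * (Fintype.card ι - 1) *
        ∑ S ∈ (Finset.univ : Finset ι).powersetCard k, ‖∑ j ∈ S, a j‖ ^ 2 =
      (Fintype.card ι).choose k *
        (k * (Fintype.card ι - k) * ∑ j, ‖a j‖ ^ 2 + k * (k - 1) * ‖∑ j, a j‖ ^ 2) := by
  classical
  have hcount (T : Finset ι) :
      ((Fintype.card ι).choose T.card : ℝ) *
        (((Finset.univ : Finset ι).powersetCard k).filter (fun S => T ⊆ S)).card =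
      (Fintype.card ι).choose k * k.choose T.card := by
    exact_mod_cast Finset.choose_card_mul_card_filter_subset k T
  have hexpand : ∑ S ∈ (Finset.univ : Finset ι).powersetCard k, ‖∑ j ∈ S, a j‖ ^ 2 =
      ∑ i, ∑ j, ((((Finset.univ : Finset ι).powersetCard k).filter
        (fun S => {i, j} ⊆ S)).card : ℝ) * ⟪a i, a j⟫ := by
    have hS (S : Finset ι) : ‖∑ j ∈ S, a j‖ ^ 2 =
        ∑ i, ∑ j, if {i, j} ⊆ S then ⟪a i, a j⟫ else 0 := by
      rw [← real_inner_self_eq_norm_sq, sum_inner]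
      simp_rw [inner_sum, Finset.insert_subset_iff, Finset.singleton_subset_iff, ite_and]
      simp [Finset.sum_ite_mem, Finset.sum_ite_irrel]
    simp_rw [hS]
    rw [Finset.sum_comm]
    refine Finset.sum_congr rfl fun i _ => ?_
    rw [Finset.sum_comm]
    refine Finset.sum_congr rfl fun j _ => ?_
    rw [← Finset.sum_filter, Finset.sum_const, nsmul_eq_mul]
  have hterm (i j : ι) : (Fintype.card ι : ℝ) * (Fintype.card ι - 1) *
      (((((Finset.univ : Finset ι).powersetCard k).filter
        (fun S => {i, j} ⊆ S)).card : ℝ) * ⟪a i, a j⟫) =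
      (Fintype.card ι).choose k * (k * (Fintype.card ι - k) * (if i = j then ⟪a i, a j⟫ else 0)
        + k * (k - 1) * ⟪a i, a j⟫) := by
    have h := hcount {i, j}
    by_cases hij : i = j
    · subst hij
      rw [Finset.pair_eq_singleton, Finset.card_singleton, Nat.choose_one_right,
        Nat.choose_one_right] at h
      rw [Finset.pair_eq_singleton, if_pos rfl]
      linear_combination (Fintype.card ι - 1 : ℝ) * ⟪a i, a i⟫ * h
    · rw [Finset.card_pair hij, Nat.cast_choose_two, Nat.cast_choose_two] at h
      rw [if_neg hij]
      linear_combination 2 * ⟪a i, a j⟫ * h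
  have hsq : ‖∑ j, a j‖ ^ 2 = ∑ i, ∑ j, ⟪a i, a j⟫ := by
    rw [← real_inner_self_eq_norm_sq, sum_inner]
    simp_rw [inner_sum]
  have hdiag : ∑ j, ‖a j‖ ^ 2 = ∑ i, ∑ j, if i = j then ⟪a i, a j⟫ else 0 := by
    simp
  rw [hexpand, hsq, hdiag]
  simp_rw [Finset.mul_sum, hterm, ← Finset.mul_sum, Finset.sum_add_distrib, ← Finset.mul_sum]

/-- Centering does not increase the second moment of the average over a uniformly random
`k`-subset. -/
theorem Finset.sum_powersetCard_norm_sub_mean_sq_le {ι E : Type*} [Fintype ι] [Nonempty ι]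
    [NormedAddCommGroup E] [InnerProductSpace ℝ E] {k : ℕ} (hk : 1 ≤ k) (b : ι → E) :
    ∑ S ∈ (Finset.univ : Finset ι).powersetCard k,
        ‖(k : ℝ)⁻¹ • ∑ j ∈ S, b j - (Fintype.card ι : ℝ)⁻¹ • ∑ j, b j‖ ^ 2 ≤
      ∑ S ∈ (Finset.univ : Finset ι).powersetCard k, ‖(k : ℝ)⁻¹ • ∑ j ∈ S, b j‖ ^ 2 := by
  have hk0 : (k : ℝ) ≠ 0 := by positivity
  have hn0 : (Fintype.card ι : ℝ) ≠ 0 := by positivity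
  set m := (Fintype.card ι : ℝ)⁻¹ • ∑ j, b j with hm
  have hmean : ∑ S ∈ (Finset.univ : Finset ι).powersetCard k, (k : ℝ)⁻¹ • ∑ j ∈ S, b j =
      ((Fintype.card ι).choose k : ℝ) • m := by
    have h := congrArg (fun v => ((k : ℝ)⁻¹ * (Fintype.card ι : ℝ)⁻¹) • v)
      (Finset.card_smul_sum_powersetCard_sum k b)
    simp only [smul_smul] at h
    rw [← Finset.smul_sum, hm, smul_smul]
    convert h using 2 <;> field_simp
  have hcross := congrArg (fun v => ⟪v, m⟫) hmean
  simp only [sum_inner, real_inner_smul_left _ m ((Fintype.card ι).choose k : ℝ),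
    real_inner_self_eq_norm_sq] at hcross
  simp_rw [norm_sub_sq_real]
  rw [Finset.sum_add_distrib, Finset.sum_sub_distrib, ← Finset.mul_sum, hcross, Finset.sum_const,
    Finset.card_powersetCard, Finset.card_univ, nsmul_eq_mul]
  have : 0 ≤ ((Fintype.card ι).choose k : ℝ) * ‖m‖ ^ 2 := by positivity
  linarith

/-- First variance bound in the analysis of ProxSkip-LSVRG (Appendix E): the LSVRG
estimator satisfies `E‖ĝ − ∇f(z)‖² ≤ 4L(τ)·D_f(x,z) + 2σ` where `σ` is the expected
squared norm of the subsampled control-gradient deviation. -/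
theorem lsvrg_estimator_variance_bound
    {E : Type*} [NormedAddCommGroup E] [InnerProductSpace ℝ E]
    (n τ : ℕ) (hn : 2 ≤ n) (hτ1 : 1 ≤ τ) (hτn : τ ≤ n)
    (φ : Fin n → E → ℝ) (φ' : Fin n → E → E)
    (hconv : ∀ j, ConvexOn ℝ Set.univ (φ j))
    (hdiff : ∀ j z, HasFDerivAt (φ j) ((innerSL ℝ) (φ' j z)) z)
    (Lj : Fin n → ℝ) (hLj : ∀ j, 0 < Lj j)
    (hsmoothj : ∀ j x y, φ j x - φ j y - ⟪φ' j y, x - y⟫ ≤ Lj j / 2 * ‖x - y‖ ^ 2)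
    (Lmax : ℝ) (hLmax : IsGreatest (Set.range Lj) Lmax)
    (f : E → ℝ) (hf : f = fun x => ((n : ℝ))⁻¹ * ∑ j, φ j x)
    (f' : E → E) (hf' : ∀ w, f' w = ((n : ℝ))⁻¹ • ∑ j, φ' j w)
    (hfconv : ConvexOn ℝ Set.univ f)
    (L : ℝ) (hL : 0 < L)
    (hsmooth : ∀ x y, f x - f y - ⟪f' y, x - y⟫ ≤ L / 2 * ‖x - y‖ ^ 2)
    (Lτ : ℝ)
    (hLτ : Lτ = ((n : ℝ) - τ) / (τ * ((n : ℝ) - 1)) * Lmax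
        + (n : ℝ) * ((τ : ℝ) - 1) / (τ * ((n : ℝ) - 1)) * L) :
    ∀ x y z : E,
      ((n.choose τ : ℝ))⁻¹ *
          ∑ S ∈ Finset.powersetCard τ (Finset.univ : Finset (Fin n)),
            ‖((τ : ℝ))⁻¹ • (∑ j ∈ S, (φ' j x - φ' j y)) + (f' y - f' z)‖ ^ 2 ≤
        4 * Lτ * (f x - f z - ⟪f' z, x - z⟫)
          + 2 * (((n.choose τ : ℝ))⁻¹ *
              ∑ S ∈ Finset.powersetCard τ (Finset.univ : Finset (Fin n)),
                ‖((τ : ℝ))⁻¹ • ∑ j ∈ S, (φ' j y - φ' j z)‖ ^ 2) := by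
  intro x y z
  have hn0 : (0 : ℝ) < n := by positivity
  have hn1 : (0 : ℝ) < n - 1 := by
    have : (2 : ℝ) ≤ n := by exact_mod_cast hn
    linarith
  have hτ0 : (0 : ℝ) < τ := by positivity
  have hτ1' : (0 : ℝ) ≤ τ - 1 := by
    have : (1 : ℝ) ≤ τ := by exact_mod_cast hτ1
    linarith
  have hτn' : (0 : ℝ) ≤ n - τ := by
    have : (τ : ℝ) ≤ n := by exact_mod_cast hτn
    linarith
  have hC : (0 : ℝ) < n.choose τ := by exact_mod_cast Nat.choose_pos hτn
  have : Nonempty (Fin n) := ⟨⟨0, by omega⟩⟩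
  have htangentj (j : Fin n) (u v : E) : φ j v + ⟪φ' j v, u - v⟫ ≤ φ j u :=
    (hconv j).add_inner_le_of_hasFDerivAt (hdiff j v) u
  have hbregman (u v : E) : f u - f v - ⟪f' v, u - v⟫ =
      (n : ℝ)⁻¹ * ∑ j, (φ j u - φ j v - ⟪φ' j v, u - v⟫) := by
    rw [hf, hf', real_inner_smul_left, sum_inner, Finset.sum_sub_distrib, Finset.sum_sub_distrib]
    ring
  have htangent (u v : E) : f v + ⟪f' v, u - v⟫ ≤ f u := by
    have : 0 ≤ f u - f v - ⟪f' v, u - v⟫ := by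
      rw [hbregman]
      refine mul_nonneg (by positivity) (Finset.sum_nonneg fun j _ => ?_)
      linarith [htangentj j u v]
    linarith
  set D := f x - f z - ⟪f' z, x - z⟫ with hD
  have hmean (u v : E) : f' u - f' v = (n : ℝ)⁻¹ • ∑ j, (φ' j u - φ' j v) := by
    rw [hf', hf', ← smul_sub, Finset.sum_sub_distrib]
  have hsum : ∑ j, ‖φ' j x - φ' j z‖ ^ 2 ≤ 2 * Lmax * (n * D) := by
    rw [hD, hbregman, mul_inv_cancel_left₀ hn0.ne', Finset.mul_sum]
    refine Finset.sum_le_sum fun j _ => ?_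
    refine (norm_sub_sq_le_bregman (hLj j) (htangentj j) (hsmoothj j) x z).trans ?_
    have hle : Lj j ≤ Lmax := hLmax.2 (Set.mem_range_self j)
    refine mul_le_mul_of_nonneg_right (by linarith) ?_
    linarith [htangentj j x z]
  have hfull : ‖∑ j, (φ' j x - φ' j z)‖ ^ 2 ≤ n ^ 2 * (2 * L * D) := by
    have h := norm_sub_sq_le_bregman hL htangent hsmooth x z
    rw [hmean, norm_smul, mul_pow, norm_inv, Real.norm_natCast, inv_pow,
      inv_mul_le_iff₀ (by positivity)] at h
    exact h
  have hA : (n.choose τ : ℝ)⁻¹ * ∑ S ∈ Finset.powersetCard τ (Finset.univ : Finset (Fin n)),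
      ‖(τ : ℝ)⁻¹ • ∑ j ∈ S, (φ' j x - φ' j z)‖ ^ 2 ≤ 2 * Lτ * D := by
    have h := Finset.card_mul_sum_powersetCard_norm_sum_sq τ (fun j => φ' j x - φ' j z)
    rw [Fintype.card_fin] at h
    simp_rw [norm_smul, mul_pow, ← Finset.mul_sum]
    rw [norm_inv, Real.norm_natCast, inv_pow, inv_mul_le_iff₀ hC, inv_mul_le_iff₀ (by positivity)]
    refine le_of_mul_le_mul_left (h.trans_le ?_) (mul_pos hn0 hn1)
    calc _ ≤ (n.choose τ : ℝ) * (τ * (n - τ) * (2 * Lmax * (n * D))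
          + τ * (τ - 1) * (n ^ 2 * (2 * L * D))) := by gcongr
      _ = _ := by
        rw [hLτ]
        field_simp
  have hB := Finset.sum_powersetCard_norm_sub_mean_sq_le hτ1 (fun j => φ' j y - φ' j z)
  rw [Fintype.card_fin, ← hmean y z] at hB
  have hpoint (S : Finset (Fin n)) :
      ‖(τ : ℝ)⁻¹ • (∑ j ∈ S, (φ' j x - φ' j y)) + (f' y - f' z)‖ ^ 2 ≤
        2 * ‖(τ : ℝ)⁻¹ • ∑ j ∈ S, (φ' j x - φ' j z)‖ ^ 2
          + 2 * ‖(τ : ℝ)⁻¹ • ∑ j ∈ S, (φ' j y - φ' j z) - (f' y - f' z)‖ ^ 2 := by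
    have hsplit : (τ : ℝ)⁻¹ • (∑ j ∈ S, (φ' j x - φ' j y)) + (f' y - f' z) =
        (τ : ℝ)⁻¹ • ∑ j ∈ S, (φ' j x - φ' j z)
          - ((τ : ℝ)⁻¹ • ∑ j ∈ S, (φ' j y - φ' j z) - (f' y - f' z)) := by
      simp only [Finset.sum_sub_distrib, smul_sub]
      abel
    rw [hsplit]
    generalize (τ : ℝ)⁻¹ • ∑ j ∈ S, (φ' j x - φ' j z) = u
    generalize (τ : ℝ)⁻¹ • ∑ j ∈ S, (φ' j y - φ' j z) - (f' y - f' z) = v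
    have := parallelogram_law_with_norm ℝ u v
    nlinarith [mul_self_nonneg ‖u + v‖]
  have hfinal := Finset.sum_le_sum fun S
    (_ : S ∈ Finset.powersetCard τ (Finset.univ : Finset (Fin n))) => hpoint S
  rw [Finset.sum_add_distrib, ← Finset.mul_sum, ← Finset.mul_sum] at hfinal
  have hfinal' := mul_le_mul_of_nonneg_left
    (hfinal.trans (add_le_add_right (mul_le_mul_of_nonneg_left hB zero_le_two) _))
    (inv_nonneg.2 hC.le)
  linarith
end
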